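/- arXiv:1611.09304 — 2 statements merged into one kernel-verified Lean document; each statement's English description precedes it below -/
import Mathlib

section
/- For any finitely supported probability distribution p on arrival sequences (a demand profile), the expected user dissatisfaction function c_p(d,b) = Σ_X p(X)·c^X(d,b) is multimodular. -/
/-- One step of the station dynamics. -/
def step (cap : ℕ) (b : ℕ) (x : ℤ) : ℕ :=
  (max 0 (min (cap : ℤ) ((b : ℤ) + x))).toNat

/-- Number of out-of-stock events for arrival list `X`, capacity `cap`, starting bikes `b`. -/
def cost (cap : ℕ) : ℕ → List ℤ → ℕ
  | _, [] => 0
  | b, x :: xs => (if step cap b x = b then 1 else 0) + cost cap (step cap b x) xs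

/-- The user dissatisfaction function `c^X(d,b)`. -/
def udf (X : List ℤ) (d b : ℕ) : ℕ := cost (d + b) b X

/-- Multimodularity of `f : ℕ² → ℝ`. -/
def Multimodular (f : ℕ → ℕ → ℝ) : Prop :=
  (∀ d b : ℕ, f (d+1) (b+1) - f (d+1) b ≥ f d (b+1) - f d b) ∧
  (∀ d b : ℕ, f d (b+2) - f d (b+1) ≥ f (d+1) (b+1) - f (d+1) b) ∧
  (∀ d b : ℕ, f (d+2) b - f (d+1) b ≥ f (d+1) (b+1) - f d (b+1))

theorem udf_nil (d b : ℕ) : udf [] d b = 0 := rfl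

theorem udf_ret_zero (X : List ℤ) (b : ℕ) : udf (1 :: X) 0 b = 1 + udf X 0 b := by
  have h : step (0 + b) b 1 = b := by unfold step; omega
  simp only [udf, cost, h, if_true]

theorem udf_ret_succ (X : List ℤ) (d b : ℕ) : udf (1 :: X) (d + 1) b = udf X d (b + 1) := by
  have h : step (d + 1 + b) b 1 = b + 1 := by unfold step; omega
  have e : d + 1 + b = d + (b + 1) := by omega
  simp only [udf, cost, h]
  rw [if_neg (by omega), e, zero_add]

theorem udf_rent_zero (X : List ℤ) (d : ℕ) : udf (-1 :: X) d 0 = 1 + udf X d 0 := by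
  have h : step (d + 0) 0 (-1) = 0 := by unfold step; omega
  simp only [udf, cost, h, if_true]

theorem udf_rent_succ (X : List ℤ) (d b : ℕ) : udf (-1 :: X) d (b + 1) = udf X (d + 1) b := by
  have h : step (d + (b + 1)) (b + 1) (-1) = b := by unfold step; omega
  have e : d + (b + 1) = d + 1 + b := by omega
  simp only [udf, cost, h]
  rw [if_neg (by omega), e, zero_add]

/-- The three multimodularity inequalities and two unit-Lipschitz bounds, proved together. -/
theorem udf_main (X : List ℤ) (hX : ∀ x ∈ X, x = 1 ∨ x = -1) :
    (∀ d b, udf X (d+1) b + udf X d (b+1) ≤ udf X (d+1) (b+1) + udf X d b) ∧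
    (∀ d b, udf X (d+1) (b+1) + udf X d (b+1) ≤ udf X d (b+2) + udf X (d+1) b) ∧
    (∀ d b, udf X (d+1) (b+1) + udf X (d+1) b ≤ udf X (d+2) b + udf X d (b+1)) ∧
    (∀ d b, udf X d (b+1) ≤ udf X (d+1) b + 1) ∧
    (∀ d b, udf X (d+1) b ≤ udf X d (b+1) + 1) := by
  induction X with
  | nil => simp [udf_nil]
  | cons x X ih =>
    obtain ⟨h1, h2, h3, h4, h5⟩ := ih (fun y hy => hX y (List.mem_cons_of_mem _ hy))
    rcases hX x List.mem_cons_self with rfl | rfl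
    · refine ⟨?_, ?_, ?_, ?_, ?_⟩ <;> intro d b <;> rcases d with _ | d <;>
        simp only [udf_ret_zero, udf_ret_succ, zero_add] <;>
        have a1 := h1 0 b <;> have a2 := h2 0 b <;> have a3 := h3 0 b <;>
        have a4 := h4 0 (b+1) <;> have a5 := h5 0 (b+1) <;>
        (try have c1 := h1 d (b+1)) <;> (try have c2 := h2 d (b+1)) <;>
        (try have c3 := h3 d (b+1)) <;>
        (try have c4 := h4 d (b+1)) <;> (try have c5 := h5 d (b+1)) <;>
        simp only [zero_add, add_assoc, Nat.reduceAdd] at * <;> omega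
    · refine ⟨?_, ?_, ?_, ?_, ?_⟩ <;> intro d b <;> rcases b with _ | b <;>
        simp only [udf_rent_zero, udf_rent_succ, zero_add] <;>
        have a1 := h1 d 0 <;> have a2 := h2 d 0 <;> have a3 := h3 d 0 <;>
        have a4 := h4 (d+1) 0 <;> have a5 := h5 (d+1) 0 <;>
        (try have c1 := h1 (d+1) b) <;> (try have c2 := h2 (d+1) b) <;>
        (try have c3 := h3 (d+1) b) <;>
        (try have c4 := h4 (d+1) b) <;> (try have c5 := h5 (d+1) b) <;>
        (try rw [udf_rent_succ X d (b+1)]) <;>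
        (try rw [udf_rent_succ X d 1]) <;>
        simp only [zero_add, add_assoc, Nat.reduceAdd] at * <;> omega

/-- For a finitely supported probability distribution `p` (supported on the finite set `S`
of arrival sequences, each a ±1 sequence), the expected user dissatisfaction function
`c_p(d,b) = Σ_X p(X)·c^X(d,b)` is multimodular. -/
theorem expected_udf_multimodular (S : Finset (List ℤ)) (p : List ℤ → ℝ)
    (hnonneg : ∀ X ∈ S, 0 ≤ p X) (hsum : ∑ X ∈ S, p X = 1)
    (hpm : ∀ X ∈ S, ∀ x ∈ X, x = 1 ∨ x = -1) :
    Multimodular (fun d b => ∑ X ∈ S, p X * (udf X d b : ℝ)) := by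
  have key : ∀ A B C D : List ℤ → ℕ, (∀ X ∈ S, C X + D X ≤ A X + B X) →
      (∑ X ∈ S, p X * (A X : ℝ)) - ∑ X ∈ S, p X * (D X : ℝ) ≥
        (∑ X ∈ S, p X * (C X : ℝ)) - ∑ X ∈ S, p X * (B X : ℝ) := by
    intro A B C D h
    rw [ge_iff_le, ← Finset.sum_sub_distrib, ← Finset.sum_sub_distrib]
    refine Finset.sum_le_sum fun X hX => ?_
    rw [← mul_sub, ← mul_sub]
    refine mul_le_mul_of_nonneg_left ?_ (hnonneg X hX)
    have : (C X : ℝ) + D X ≤ A X + B X := by exact_mod_cast h X hX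
    linarith
  refine ⟨fun d b => key _ _ _ _ fun X hX => ?_, fun d b => key _ _ _ _ fun X hX => ?_,
    fun d b => key _ _ _ _ fun X hX => ?_⟩
  · have := (udf_main X (hpm X hX)).1 d b
    omega
  · have := (udf_main X (hpm X hX)).2.1 d b
    omega
  · have := (udf_main X (hpm X hX)).2.2.1 d b
    omega
end

section
/- For any allocation (d⃗,b⃗) over n stations and any z ≥ Σ_i (d_i+b_i), the z-ball S_z(d⃗,b⃗) contains every allocation (d⃗′,b⃗′) with Σ_i (d_i′+b_i′) = Σ_i (d_i+b_i) and Σ_i b_i′ = Σ_i b_i; consequently, starting from a bike-optimal allocation, the discrete gradient-descent sequence attains a global minimum of c over all allocations with the same totals after at most Σ_i (d_i+b_i) iterations. -/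
/-- An allocation over `n` stations: open docks and bikes at each station. -/
abbrev Alloc (n : ℕ) := (Fin n → ℕ) × (Fin n → ℕ)

/-- Objective: total expected user dissatisfaction `c(d⃗,b⃗) = Σ_i c_i(d_i,b_i)`. -/
def obj {n : ℕ} (c : Fin n → ℕ → ℕ → ℝ) (a : Alloc n) : ℝ :=
  ∑ i, c i (a.1 i) (a.2 i)

/-- Move one unit of the vector `v` from coordinate `i` to coordinate `j`. -/
def moveOne {n : ℕ} (v : Fin n → ℕ) (i j : Fin n) : Fin n → ℕ :=
  fun k => v k - (if k = i then 1 else 0) + (if k = j then 1 else 0)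

/-- The set of allocations obtained from `a` by a single dock-move from station `i` to
station `j`: one of `o_{ij}`, `e_{ij}`, `E_{ijh}`, `O_{ijh}` (defined whenever the
result is componentwise nonnegative). -/
def MoveFromTo {n : ℕ} (a : Alloc n) (i j : Fin n) : Set (Alloc n) :=
  {a' | (1 ≤ a.1 i ∧ a' = (moveOne a.1 i j, a.2)) ∨
        (1 ≤ a.2 i ∧ a' = (a.1, moveOne a.2 i j)) ∨
        (∃ h, 1 ≤ a.1 i ∧ 1 ≤ a.2 h ∧ a' = (moveOne a.1 i h, moveOne a.2 h j)) ∨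
        (∃ h, 1 ≤ a.1 h ∧ 1 ≤ a.2 i ∧ a' = (moveOne a.1 h j, moveOne a.2 i h))}

/-- The neighborhood `N(a)`: all allocations one dock-move away from `a`. -/
def Neighborhood {n : ℕ} (a : Alloc n) : Set (Alloc n) :=
  ⋃ (i : Fin n) (j : Fin n), MoveFromTo a i j

/-- Dock-move distance `Σ_i |(d_i+b_i) − (d_i′+b_i′)|`. -/
def dockDist {n : ℕ} (a a' : Alloc n) : ℕ :=
  ∑ i, ((a.1 i + a.2 i : ℤ) - (a'.1 i + a'.2 i : ℤ)).natAbs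

/-- `a` is bike-optimal: it minimizes the objective among allocations with the same
number of docks at each station and the same total number of bikes. -/
def BikeOptimal {n : ℕ} (c : Fin n → ℕ → ℕ → ℝ) (a : Alloc n) : Prop :=
  ∀ a' : Alloc n, (∀ i, a'.1 i + a'.2 i = a.1 i + a.2 i) →
    (∑ i, a'.2 i = ∑ i, a.2 i) → obj c a ≤ obj c a'

/-- The `z`-ball `S_z(a)` around allocation `a`. -/
def ball {n : ℕ} (a : Alloc n) : ℕ → Set (Alloc n)
  | 0 => {a}
  | z + 1 => ball a z ∪ ⋃ a' ∈ ball a z, Neighborhood a'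

/-- Number of docks at station `k`, as an integer. -/
def KK {n : ℕ} (a : Alloc n) (k : Fin n) : ℤ := (a.1 k : ℤ) + a.2 k

def Same {n : ℕ} (a a' : Alloc n) : Prop :=
  ∑ i, a.1 i = ∑ i, a'.1 i ∧ ∑ i, a.2 i = ∑ i, a'.2 i

/-- Indicator of a station. -/
def dl {n : ℕ} (i k : Fin n) : ℤ := if k = i then 1 else 0

lemma sum_dl {n : ℕ} (i : Fin n) : ∑ k, dl i k = 1 := by simp [dl]

lemma Same.symm {n : ℕ} {a b : Alloc n} (h : Same a b) : Same b a := ⟨h.1.symm, h.2.symm⟩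

lemma Same.trans {n : ℕ} {a b c : Alloc n} (h : Same a b) (h' : Same b c) : Same a c :=
  ⟨h.1.trans h'.1, h.2.trans h'.2⟩

lemma mm_swap {f : ℕ → ℕ → ℝ} (hf : Multimodular f) : Multimodular (fun x y => f y x) := by
  obtain ⟨h1, h2, h3⟩ := hf
  refine ⟨fun d b => ?_, fun d b => ?_, fun d b => ?_⟩
  · have := h1 b d; simp only; linarith
  · have := h3 b d; simp only; linarith
  · have := h2 b d; simp only; linarith

lemma mono_b {f : ℕ → ℕ → ℝ} (hf : Multimodular f) (d b t : ℕ) :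
    f (d+1) b - f d b ≤ f (d+1) (b+t) - f d (b+t) := by
  induction t with
  | zero => simp
  | succ t ih => have := hf.1 d (b+t); rw [← add_assoc]; linarith

lemma mono_diag {f : ℕ → ℕ → ℝ} (hf : Multimodular f) (d b t : ℕ) :
    f (d+1) (b+t) - f d (b+t) ≤ f (d+t+1) b - f (d+t) b := by
  induction t generalizing b with
  | zero => simp
  | succ t ih =>
    have h1 := hf.2.2 (d+t) b
    have h2 := ih (b+1)
    have e : b + (t+1) = b + 1 + t := by ring
    rw [e, ← add_assoc]
    have e2 : d + t + 2 = d + t + 1 + 1 := rfl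
    rw [e2] at h1
    linarith

lemma st_rem {f : ℕ → ℕ → ℝ} (hf : Multimodular f) {x y x' y' : ℕ} (h : x' < x)
    (h2 : x' + y' < x + y) : f (x-1) y + f (x'+1) y' ≤ f x y + f x' y' := by
  obtain ⟨t, rfl⟩ : ∃ t, x = x' + t + 1 := ⟨x - x' - 1, by omega⟩
  obtain ⟨s, hs⟩ : ∃ s, y + t = y' + s := ⟨y + t - y', by omega⟩
  have h3 := mono_b hf x' y' s
  have h4 := mono_diag hf x' y t
  rw [hs] at h4
  simp only [Nat.add_sub_cancel]
  linarith

lemma sw1 {f : ℕ → ℕ → ℝ} (hf : Multimodular f) (d b t : ℕ) :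
    f (d+1) b - f d (b+1) ≤ f (d+t+1) b - f (d+t) (b+1) := by
  induction t with
  | zero => simp
  | succ t ih =>
    have h1 := hf.2.2 (d+t) b
    have e2 : d + t + 2 = d + (t + 1) + 1 := by ring
    rw [e2] at h1
    rw [show d + (t+1) = d + t + 1 by ring] at *
    linarith

lemma sw2 {f : ℕ → ℕ → ℝ} (hf : Multimodular f) (d b t : ℕ) :
    f (d+1) (b+t) - f d (b+t+1) ≤ f (d+1) b - f d (b+1) := by
  have := sw1 (mm_swap hf) b d t
  linarith

/-- swap of a `y` unit into an `x` unit -/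
lemma st_swap {f : ℕ → ℕ → ℝ} (hf : Multimodular f) {x y x' y' : ℕ} (h : x < x')
    (h2 : y' < y) : f (x+1) (y-1) + f (x'-1) (y'+1) ≤ f x y + f x' y' := by
  obtain ⟨t, rfl⟩ : ∃ t, x' = x + t + 1 := ⟨x' - x - 1, by omega⟩
  obtain ⟨s, rfl⟩ : ∃ s, y = y' + s + 1 := ⟨y - y' - 1, by omega⟩
  have h3 := sw1 hf x y' t
  have h4 := sw2 hf x y' s
  simp only [Nat.add_sub_cancel]
  linarith

lemma moveOne_cast {n : ℕ} (v : Fin n → ℕ) (i j : Fin n) (h : 1 ≤ v i) (k : Fin n) :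
    (moveOne v i j k : ℤ) = v k - dl i k + dl j k := by
  unfold moveOne dl
  by_cases h1 : k = i
  · subst h1; split_ifs <;> push_cast <;> omega
  · split_ifs <;> push_cast <;> omega

lemma moveOne_sum {n : ℕ} (v : Fin n → ℕ) (i j : Fin n) (h : 1 ≤ v i) :
    ∑ k, moveOne v i j k = ∑ k, v k := by
  have : (∑ k, (moveOne v i j k : ℤ)) = ∑ k, (v k : ℤ) := by
    simp only [moveOne_cast v i j h, Finset.sum_add_distrib, Finset.sum_sub_distrib, sum_dl]
    ring
  exact_mod_cast this

lemma move_props {n : ℕ} {a x : Alloc n} {i j : Fin n} (h : x ∈ MoveFromTo a i j) :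
    (∀ k, KK x k = KK a k - dl i k + dl j k) ∧ Same x a := by
  rcases h with ⟨h1, rfl⟩ | ⟨h1, rfl⟩ | ⟨h, h1, h2, rfl⟩ | ⟨h, h1, h2, rfl⟩
  · refine ⟨fun k => ?_, moveOne_sum _ _ _ h1, rfl⟩
    simp only [KK, moveOne_cast _ _ _ h1]; ring
  · refine ⟨fun k => ?_, rfl, moveOne_sum _ _ _ h1⟩
    simp only [KK, moveOne_cast _ _ _ h1]; ring
  · refine ⟨fun k => ?_, moveOne_sum _ _ _ h1, moveOne_sum _ _ _ h2⟩
    simp only [KK, moveOne_cast _ _ _ h1, moveOne_cast _ _ _ h2]; ring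
  · refine ⟨fun k => ?_, moveOne_sum _ _ _ h1, moveOne_sum _ _ _ h2⟩
    simp only [KK, moveOne_cast _ _ _ h1, moveOne_cast _ _ _ h2]; ring

lemma exists_lt_of_sum {n : ℕ} {f g : Fin n → ℕ} (h : ∑ i, f i = ∑ i, g i) {u : Fin n}
    (hu : g u < f u) : ∃ v, f v < g v := by
  by_contra hcon
  push Not at hcon
  have := Finset.sum_lt_sum (s := Finset.univ) (fun i _ => hcon i) ⟨u, Finset.mem_univ _, hu⟩
  omega

/-- Full L1 distance. -/
def fdist {n : ℕ} (a a' : Alloc n) : ℤ :=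
  ∑ i, (|(a.1 i : ℤ) - a'.1 i| + |(a.2 i : ℤ) - a'.2 i|)

lemma obj_pair_le {n : ℕ} {c : Fin n → ℕ → ℕ → ℝ} {a b p q : Alloc n}
    (h : ∀ k, c k (p.1 k) (p.2 k) + c k (q.1 k) (q.2 k) ≤
      c k (a.1 k) (a.2 k) + c k (b.1 k) (b.2 k)) :
    obj c p + obj c q ≤ obj c a + obj c b := by
  unfold obj
  rw [← Finset.sum_add_distrib, ← Finset.sum_add_distrib]
  exact Finset.sum_le_sum fun k _ => h k

def StepConcl {n : ℕ} (c : Fin n → ℕ → ℕ → ℝ) (a s : Alloc n) (u : Fin n) : Prop :=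
  (∃ v, KK a v < KK s v ∧ ∃ p ∈ MoveFromTo a u v, ∃ q ∈ MoveFromTo s v u,
    obj c p + obj c q ≤ obj c a + obj c s) ∨
  (∃ a' s' : Alloc n, (∀ k, KK a' k = KK a k) ∧ (∀ k, KK s' k = KK s k) ∧ Same a' a ∧ Same s' s ∧
    fdist a s' < fdist a s ∧ obj c a' + obj c s' ≤ obj c a + obj c s)

lemma step_d {n : ℕ} {c : Fin n → ℕ → ℕ → ℝ} (hc : ∀ i, Multimodular (c i))
    {a s : Alloc n} (hs : Same a s) {u : Fin n} (hu : KK s u < KK a u) (hd : s.1 u < a.1 u) :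
    StepConcl c a s u := by
  obtain ⟨v, hv⟩ := exists_lt_of_sum hs.1 hd
  have huv : u ≠ v := by rintro rfl; omega
  have R := fun k => @st_rem (c k) (hc k)
  have R' := fun k => @st_rem _ (mm_swap (hc k))
  have S := fun k => @st_swap (c k) (hc k)
  have S' := fun k => @st_swap _ (mm_swap (hc k))
  beta_reduce at R' S'
  unfold KK at hu
  by_cases hkv : KK a v < KK s v
  · left
    refine ⟨v, hkv, _, Or.inl ⟨by omega, rfl⟩, _, Or.inl ⟨by omega, rfl⟩, obj_pair_le fun k => ?_⟩
    unfold KK at hkv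
    by_cases h1 : k = u
    · subst h1
      simpa [moveOne, huv] using R k hd (by omega : s.1 k + s.2 k < a.1 k + a.2 k)
    by_cases h2 : k = v
    · subst h2
      have := R k hv (by omega : a.1 k + a.2 k < s.1 k + s.2 k)
      simp [moveOne, huv.symm]; linarith
    simp [moveOne, h1, h2]
  unfold KK at hkv
  have hbv : s.2 v < a.2 v := by omega
  obtain ⟨w, hw⟩ := exists_lt_of_sum hs.2 hbv
  have hvw : v ≠ w := by rintro rfl; omega
  by_cases hkw : KK a w < KK s w
  · left
    refine ⟨w, hkw, _, Or.inr (Or.inr (Or.inl ⟨v, by omega, by omega, rfl⟩)), _,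
      Or.inr (Or.inr (Or.inr ⟨v, by omega, by omega, rfl⟩)), obj_pair_le fun k => ?_⟩
    unfold KK at hkw
    have huw : u ≠ w := by rintro rfl; omega
    by_cases h1 : k = u
    · subst h1
      simpa [moveOne, huv, huw] using R k hd (by omega : s.1 k + s.2 k < a.1 k + a.2 k)
    by_cases h2 : k = v
    · subst h2
      have := S k hv hbv
      simpa [moveOne, huv.symm, hvw] using this
    by_cases h3 : k = w
    · subst h3
      have := R' k hw (by omega : a.2 k + a.1 k < s.2 k + s.1 k)
      simp [moveOne, huw.symm, hvw.symm]; linarith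
    simp [moveOne, h1, h2, h3]
  · right
    unfold KK at hkw
    have hdw : s.1 w < a.1 w := by omega
    have e1 := moveOne_cast a.1 w v (by omega)
    have e2 := moveOne_cast a.2 v w (by omega)
    have e3 := moveOne_cast s.1 v w (by omega)
    have e4 := moveOne_cast s.2 w v (by omega)
    refine ⟨(moveOne a.1 w v, moveOne a.2 v w), (moveOne s.1 v w, moveOne s.2 w v),
      fun k => ?_, fun k => ?_, ⟨moveOne_sum _ _ _ (by omega), moveOne_sum _ _ _ (by omega)⟩,
      ⟨moveOne_sum _ _ _ (by omega), moveOne_sum _ _ _ (by omega)⟩, ?_, obj_pair_le fun k => ?_⟩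
    · simp only [KK, e1, e2]; ring
    · simp only [KK, e3, e4]; ring
    · unfold fdist
      simp only [e3, e4]
      apply Finset.sum_lt_sum
      · intro k _
        unfold dl
        by_cases h2 : k = v
        · subst h2; simp only [hvw, if_true, if_false, Int.abs_eq_natAbs]; omega
        by_cases h3 : k = w
        · subst h3; simp only [h2, if_true, if_false, Int.abs_eq_natAbs]; omega
        simp [h2, h3]
      · refine ⟨v, Finset.mem_univ _, ?_⟩
        simp only [dl, hvw, if_true, if_false, Int.abs_eq_natAbs]; omega
    · by_cases h2 : k = v
      · subst h2
        have := S k hv hbv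
        simpa [moveOne, hvw] using this
      by_cases h3 : k = w
      · subst h3
        have := S' k hw hdw
        simpa [moveOne, hvw.symm] using this
      simp [moveOne, h2, h3]

lemma KK_swap {n : ℕ} (a : Alloc n) (k : Fin n) : KK a.swap k = KK a k := by
  simp [KK, add_comm]

lemma Same_swap {n : ℕ} {a b : Alloc n} (h : Same a b) : Same a.swap b.swap := ⟨h.2, h.1⟩

lemma obj_swap {n : ℕ} (c : Fin n → ℕ → ℕ → ℝ) (a : Alloc n) :
    obj (fun i x y => c i y x) a = obj c a.swap := rfl

lemma fdist_swap {n : ℕ} (a b : Alloc n) : fdist a.swap b.swap = fdist a b := by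
  simp [fdist, add_comm]

lemma move_swap {n : ℕ} {a x : Alloc n} {i j : Fin n} (h : x ∈ MoveFromTo a.swap i j) :
    x.swap ∈ MoveFromTo a i j := by
  rcases h with ⟨h1, rfl⟩ | ⟨h1, rfl⟩ | ⟨h, h1, h2, rfl⟩ | ⟨h, h1, h2, rfl⟩
  · exact Or.inr (Or.inl ⟨h1, rfl⟩)
  · exact Or.inl ⟨h1, rfl⟩
  · exact Or.inr (Or.inr (Or.inr ⟨h, h2, h1, rfl⟩))
  · exact Or.inr (Or.inr (Or.inl ⟨h, h2, h1, rfl⟩))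

lemma step_s13 {n : ℕ} {c : Fin n → ℕ → ℕ → ℝ} (hc : ∀ i, Multimodular (c i))
    {a s : Alloc n} (hs : Same a s) {u : Fin n} (hu : KK s u < KK a u) :
    StepConcl c a s u := by
  by_cases hd : s.1 u < a.1 u
  · exact step_d hc hs hu hd
  have hb : s.2 u < a.2 u := by unfold KK at hu; omega
  have := step_d (c := fun i x y => c i y x) (fun i => mm_swap (hc i)) (Same_swap hs) (u := u)
    (by simpa only [KK_swap] using hu) hb
  rcases this with ⟨v, hv, p, hp, q, hq, h⟩ | ⟨a', s', h1, h2, h3, h4, h5, h6⟩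
  · left
    simp only [KK_swap, obj_swap, Prod.swap_swap] at hv h
    exact ⟨v, hv, _, move_swap hp, _, move_swap hq, h⟩
  · right
    simp only [obj_swap, Prod.swap_swap] at h6
    refine ⟨a'.swap, s'.swap, fun k => ?_, fun k => ?_, Same_swap h3, Same_swap h4, ?_, h6⟩
    · rw [KK_swap, h1, KK_swap]
    · rw [KK_swap, h2, KK_swap]
    · rw [← fdist_swap a s, ← fdist_swap a]; exact h5

lemma bo {n : ℕ} {c : Fin n → ℕ → ℕ → ℝ} {a x : Alloc n} (h : BikeOptimal c a)
    (hk : ∀ k, KK x k = KK a k) (hs : Same x a) : obj c a ≤ obj c x :=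
  h x (fun i => by have := hk i; unfold KK at this; omega) hs.2

lemma fdist_nonneg {n : ℕ} (a b : Alloc n) : 0 ≤ fdist a b :=
  Finset.sum_nonneg fun _ _ => by positivity

/-- Exchange property. -/
lemma exch {n : ℕ} {c : Fin n → ℕ → ℕ → ℝ} (hc : ∀ i, Multimodular (c i))
    {a : Alloc n} (ha : BikeOptimal c a) {u : Fin n} (m : ℕ) :
    ∀ s : Alloc n, fdist a s ≤ m → Same a s → KK s u < KK a u →
    ∃ v, KK a v < KK s v ∧ ∃ p ∈ MoveFromTo a u v, ∃ q, Same q a ∧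
      (∀ k, KK q k = KK s k + dl u k - dl v k) ∧ obj c p + obj c q ≤ obj c a + obj c s := by
  induction m with
  | zero =>
    intro s hm hs hu
    rcases step_s13 hc hs hu with ⟨v, hv, p, hp, q, hq, h⟩ | ⟨a', s', h1, h2, h3, h4, h5, h6⟩
    · obtain ⟨h1, h2⟩ := move_props hq
      exact ⟨v, hv, p, hp, q, h2.trans hs.symm, fun k => by rw [h1]; ring, h⟩
    · have := fdist_nonneg a s'
      push_cast at hm; omega
  | succ m ih =>
    intro s hm hs hu
    rcases step_s13 hc hs hu with ⟨v, hv, p, hp, q, hq, h⟩ | ⟨a', s', h1, h2, h3, h4, h5, h6⟩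
    · obtain ⟨h1, h2⟩ := move_props hq
      exact ⟨v, hv, p, hp, q, h2.trans hs.symm, fun k => by rw [h1]; ring, h⟩
    · have h7 := bo ha h1 h3
      obtain ⟨v, hv, p, hp, q, hq, hk, h⟩ := ih s' (by push_cast at hm; omega)
        (hs.trans h4.symm) (by rw [h2]; exact hu)
      refine ⟨v, by rw [← h2]; exact hv, p, hp, q, hq, fun k => by rw [hk, h2], ?_⟩
      linarith

lemma exch' {n : ℕ} {c : Fin n → ℕ → ℕ → ℝ} (hc : ∀ i, Multimodular (c i))
    {a : Alloc n} (ha : BikeOptimal c a) {u : Fin n} {s : Alloc n} (hs : Same a s)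
    (hu : KK s u < KK a u) :
    ∃ v, KK a v < KK s v ∧ ∃ p ∈ MoveFromTo a u v, ∃ q, Same q a ∧
      (∀ k, KK q k = KK s k + dl u k - dl v k) ∧ obj c p + obj c q ≤ obj c a + obj c s :=
  exch hc ha (fdist a s).toNat s (by omega) hs hu

lemma move_nbr {n : ℕ} {a x : Alloc n} {i j : Fin n} (h : x ∈ MoveFromTo a i j) :
    x ∈ Neighborhood a := Set.mem_iUnion.2 ⟨i, Set.mem_iUnion.2 ⟨j, h⟩⟩

/-- If `x'` is best in the neighbourhood of the bike-optimal `x`, it beats everything whose docks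
are obtained by one dock move. -/
lemma best_le {n : ℕ} {c : Fin n → ℕ → ℕ → ℝ} (hc : ∀ i, Multimodular (c i))
    {x x' : Alloc n} (hx : BikeOptimal c x)
    (hmin : ∀ y ∈ Neighborhood x ∪ {x}, obj c x' ≤ obj c y) {i j : Fin n} {q : Alloc n}
    (hq : Same q x) (hk : ∀ k, KK q k = KK x k - dl i k + dl j k) : obj c x' ≤ obj c q := by
  by_cases hij : i = j
  · subst hij
    exact (hmin x (Or.inr rfl)).trans (bo hx (fun k => by rw [hk]; ring) hq)
  · have hu : KK q i < KK x i := by rw [hk]; simp [dl, hij]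
    obtain ⟨v, hv, p, hp, r, hr, hrk, h⟩ := exch' hc hx hq.symm hu
    have hvj : v = j := by
      by_contra hne
      rw [hk] at hv; simp only [dl, hne, if_false] at hv; split_ifs at hv <;> omega
    subst hvj
    have h1 := bo hx (fun k => by rw [hrk, hk]; ring) hr
    have h2 := hmin p (Or.inl (move_nbr hp))
    linarith

lemma bo_step {n : ℕ} {c : Fin n → ℕ → ℕ → ℝ} (hc : ∀ i, Multimodular (c i))
    {x x' : Alloc n} (hx : BikeOptimal c x) (hmem : x' ∈ Neighborhood x ∪ {x})
    (hmin : ∀ y ∈ Neighborhood x ∪ {x}, obj c x' ≤ obj c y) :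
    BikeOptimal c x' ∧ Same x' x := by
  rcases hmem with hmem | hmem
  · obtain ⟨i, hi⟩ := Set.mem_iUnion.1 hmem
    obtain ⟨j, hj⟩ := Set.mem_iUnion.1 hi
    obtain ⟨h1, h2⟩ := move_props hj
    refine ⟨fun y hy hb => ?_, h2⟩
    have hk : ∀ k, KK y k = KK x' k := fun k => by
      have := hy k; unfold KK; omega
    have hs : Same y x' := by
      refine ⟨?_, hb⟩
      have : ∑ i, (y.1 i + y.2 i) = ∑ i, (x'.1 i + x'.2 i) := Finset.sum_congr rfl fun i _ => hy i
      rw [Finset.sum_add_distrib, Finset.sum_add_distrib] at this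
      omega
    exact best_le hc hx hmin (hs.trans h2) (i := i) (j := j) (fun k => by rw [hk, h1])
  · rw [Set.mem_singleton_iff] at hmem
    subst hmem
    exact ⟨hx, rfl, rfl⟩

def kdist {n : ℕ} (a b : Alloc n) : ℤ := ∑ k, |KK a k - KK b k|

lemma kdist_le {n : ℕ} {a b a' b' : Alloc n} {i j : Fin n} {α β : ℤ}
    (h : ∀ k, |KK a' k - KK b' k| ≤ |KK a k - KK b k| + α * dl i k + β * dl j k) :
    kdist a' b' ≤ kdist a b + α + β := by
  have := Finset.sum_le_sum (s := Finset.univ) fun k _ => h k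
  simp only [Finset.sum_add_distrib, ← Finset.mul_sum, sum_dl, mul_one] at this
  exact this

def IsMin' {n : ℕ} (c : Fin n → ℕ → ℕ → ℝ) (x s : Alloc n) : Prop :=
  Same s x ∧ ∀ y, Same y x → obj c s ≤ obj c y

lemma IsMin'.bo {n : ℕ} {c : Fin n → ℕ → ℕ → ℝ} {x s : Alloc n} (h : IsMin' c x s) :
    BikeOptimal c s := by
  intro y hy hb
  refine h.2 y (Same.trans ?_ h.1)
  refine ⟨?_, hb⟩
  have : ∑ i, (y.1 i + y.2 i) = ∑ i, (s.1 i + s.2 i) := Finset.sum_congr rfl fun i _ => hy i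
  rw [Finset.sum_add_distrib, Finset.sum_add_distrib] at this
  omega

lemma exists_KK_lt {n : ℕ} {a s : Alloc n} (hs : Same a s) (hne : ¬ ∀ k, KK s k = KK a k) :
    ∃ u, KK s u < KK a u := by
  by_contra hcon
  push Not at hcon hne
  obtain ⟨k, hk⟩ := hne
  have h1 := Finset.sum_lt_sum (s := Finset.univ) (fun i _ => hcon i)
    ⟨k, Finset.mem_univ _, lt_of_le_of_ne (hcon k) hk.symm⟩
  have h2 : ∑ i, KK a i = ∑ i, KK s i := by
    unfold KK
    rw [Finset.sum_add_distrib, Finset.sum_add_distrib]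
    have := hs.1; have := hs.2
    zify at *
    omega
  omega

/-- If `x` is not a minimizer and `s` is a nearest minimizer, then the best neighbour of `x` is
strictly better. -/
lemma strict {n : ℕ} {c : Fin n → ℕ → ℕ → ℝ} (hc : ∀ i, Multimodular (c i))
    {x x' s : Alloc n} (hx : BikeOptimal c x)
    (hmin : ∀ y ∈ Neighborhood x ∪ {x}, obj c x' ≤ obj c y)
    (hs : IsMin' c x s) (hnear : ∀ y, IsMin' c x y → kdist x s ≤ kdist x y)
    (hxs : obj c s < obj c x) : obj c x' < obj c x := by
  have hne : ¬ ∀ k, KK s k = KK x k := fun h => by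
    have := bo hx h hs.1; linarith
  obtain ⟨u, hu⟩ := exists_KK_lt hs.1.symm hne
  obtain ⟨v, hv, p, hp, q, hq, hqk, h⟩ := exch' hc hx hs.1.symm hu
  have h1 := hmin p (Or.inl (move_nbr hp))
  have h2 : obj c s < obj c q := by
    by_contra hcon
    push Not at hcon
    have hqm : IsMin' c x q := ⟨hq, fun y hy => hcon.trans (hs.2 y hy)⟩
    have h3 := hnear q hqm
    have huv : u ≠ v := by rintro rfl; omega
    have h4 : kdist x q ≤ kdist x s + (-1) + (-1) := by
      apply kdist_le (i := u) (j := v)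
      intro k
      rw [hqk]
      unfold dl
      by_cases e1 : k = u
      · subst e1; simp only [huv, if_true, if_false, Int.abs_eq_natAbs]; omega
      by_cases e2 : k = v
      · subst e2; simp only [e1, if_true, if_false, Int.abs_eq_natAbs]; omega
      simp [e1, e2]
    omega
  linarith

/-- One best move decreases the distance to the nearest minimizer. -/
lemma approach {n : ℕ} {c : Fin n → ℕ → ℕ → ℝ} (hc : ∀ i, Multimodular (c i))
    {x x' s : Alloc n} (hx : BikeOptimal c x) (hmem : x' ∈ Neighborhood x ∪ {x})
    (hmin : ∀ y ∈ Neighborhood x ∪ {x}, obj c x' ≤ obj c y)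
    (hs : IsMin' c x s) (hnear : ∀ y, IsMin' c x y → kdist x s ≤ kdist x y)
    (hxs : obj c s < obj c x) : ∃ r, IsMin' c x r ∧ kdist x' r ≤ kdist x s - 2 := by
  have hlt := strict hc hx hmin hs hnear hxs
  obtain ⟨hx', hsame⟩ := bo_step hc hx hmem hmin
  have hmem' : x' ∈ Neighborhood x := by
    rcases hmem with h | h
    · exact h
    · rw [Set.mem_singleton_iff] at h; subst h; exact absurd hlt (lt_irrefl _)
  obtain ⟨i, hi⟩ := Set.mem_iUnion.1 hmem'
  obtain ⟨j, hj⟩ := Set.mem_iUnion.1 hi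
  obtain ⟨hk', -⟩ := move_props hj
  have hij : i ≠ j := by
    rintro rfl
    have := bo hx (fun k => by rw [hk']; ring) hsame
    linarith
  -- first adjust coordinate `i`
  have step1 : ∃ s1, IsMin' c x s1 ∧ kdist x s1 ≤ kdist x s ∧ KK s1 i < KK x i := by
    by_cases hcase : KK s i < KK x i
    · exact ⟨s, hs, le_rfl, hcase⟩
    have hu : KK x' i < KK s i := by rw [hk']; simp only [dl, hij, if_true, if_false, Int.abs_eq_natAbs]; omega
    obtain ⟨v, hv, p, hp, q, hq, hqk, h⟩ := exch' hc hs.bo (hs.1.trans hsame.symm) hu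
    obtain ⟨hpk, hps⟩ := move_props hp
    have hqx : Same q x := hq.trans hs.1
    have hpmin : IsMin' c x p ∧ v ≠ j := by
      have h1 := best_le hc hx hmin (i := v) (j := j) hqx
        (fun k => by rw [hqk, hk']; ring)
      refine ⟨⟨hps.trans hs.1, fun y hy => ?_⟩, ?_⟩
      · have := hs.2 y hy; linarith
      · rintro rfl
        have h2 := bo hx (fun k => by rw [hqk, hk']; ring) hqx
        have h3 := hs.2 p (hps.trans hs.1)
        linarith
    obtain ⟨hpm, hvj⟩ := hpmin
    have hvi : v ≠ i := by rintro rfl; omega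
    have hv2 : KK s v < KK x v := by
      rw [hk'] at hv; simpa [dl, hvj, hvi] using hv
    have hnp := hnear p hpm
    by_cases heq : KK x i < KK s i
    · have h4 : kdist x p ≤ kdist x s + (-1) + (-1) := by
        apply kdist_le (i := i) (j := v)
        intro k
        rw [hpk]
        unfold dl
        by_cases e1 : k = i
        · subst e1; simp only [hvi.symm, if_true, if_false, Int.abs_eq_natAbs]; omega
        by_cases e2 : k = v
        · subst e2; simp only [e1, if_true, if_false, Int.abs_eq_natAbs]; omega
        simp [e1, e2]
      omega
    · have h4 : kdist x p ≤ kdist x s + 1 + (-1) := by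
        apply kdist_le (i := i) (j := v)
        intro k
        rw [hpk]
        unfold dl
        by_cases e1 : k = i
        · subst e1; simp only [hvi.symm, if_true, if_false, Int.abs_eq_natAbs]; omega
        by_cases e2 : k = v
        · subst e2; simp only [e1, if_true, if_false, Int.abs_eq_natAbs]; omega
        simp [e1, e2]
      refine ⟨p, hpm, by omega, ?_⟩
      rw [hpk]; simp only [dl, hvi.symm, if_true, if_false, Int.abs_eq_natAbs]; omega
  obtain ⟨s1, hs1, hd1, hi1⟩ := step1
  have step2 : ∃ s2, IsMin' c x s2 ∧ kdist x s2 ≤ kdist x s ∧ KK s2 i < KK x i ∧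
      KK x j < KK s2 j := by
    by_cases hcase : KK x j < KK s1 j
    · exact ⟨s1, hs1, hd1, hi1, hcase⟩
    have hu : KK s1 j < KK x' j := by
      rw [hk']; simp only [dl, hij.symm, if_true, if_false, Int.abs_eq_natAbs]; omega
    obtain ⟨v, hv, p, hp, q, hq, hqk, h⟩ := exch' hc hx' (hsame.trans hs1.1.symm) hu
    obtain ⟨hpk, hps⟩ := move_props hp
    have hpx : Same p x := hps.trans hsame
    have hqx : Same q x := hq.trans hsame
    have hqmin : IsMin' c x q ∧ v ≠ i := by
      have h1 := best_le hc hx hmin (i := i) (j := v) hpx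
        (fun k => by rw [hpk, hk']; ring)
      refine ⟨⟨hqx, fun y hy => ?_⟩, ?_⟩
      · have := hs1.2 y hy; linarith
      · rintro rfl
        have h2 := bo hx (fun k => by rw [hpk, hk']; ring) hpx
        have h3 := hs1.2 q hqx
        linarith
    obtain ⟨hqm, hvi⟩ := hqmin
    have hvj : v ≠ j := by rintro rfl; omega
    have hv2 : KK x v < KK s1 v := by
      rw [hk'] at hv; simpa [dl, hvj, hvi] using hv
    have hnq := hnear q hqm
    by_cases heq : KK s1 j < KK x j
    · have h4 : kdist x q ≤ kdist x s1 + (-1) + (-1) := by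
        apply kdist_le (i := j) (j := v)
        intro k
        rw [hqk]
        unfold dl
        by_cases e1 : k = j
        · subst e1; simp only [hvj.symm, if_true, if_false, Int.abs_eq_natAbs]; omega
        by_cases e2 : k = v
        · subst e2; simp only [e1, if_true, if_false, Int.abs_eq_natAbs]; omega
        simp [e1, e2]
      omega
    · have h4 : kdist x q ≤ kdist x s1 + 1 + (-1) := by
        apply kdist_le (i := j) (j := v)
        intro k
        rw [hqk]
        unfold dl
        by_cases e1 : k = j
        · subst e1; simp only [hvj.symm, if_true, if_false, Int.abs_eq_natAbs]; omega
        by_cases e2 : k = v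
        · subst e2; simp only [e1, if_true, if_false, Int.abs_eq_natAbs]; omega
        simp [e1, e2]
      refine ⟨q, hqm, by omega, ?_, ?_⟩
      · rw [hqk]; simp only [dl, hij, hvi.symm, if_false]; omega
      · rw [hqk]; simp only [dl, hvj.symm, if_true, if_false, Int.abs_eq_natAbs]; omega
  obtain ⟨s2, hs2, hd2, hi2, hj2⟩ := step2
  refine ⟨s2, hs2, ?_⟩
  have h4 : kdist x' s2 ≤ kdist x s2 + (-1) + (-1) := by
    apply kdist_le (i := i) (j := j)
    intro k
    rw [hk']
    unfold dl
    by_cases e1 : k = i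
    · subst e1; simp only [hij, if_true, if_false, Int.abs_eq_natAbs]; omega
    by_cases e2 : k = j
    · subst e2; simp only [e1, if_true, if_false, Int.abs_eq_natAbs]; omega
    simp [e1, e2]
  omega

lemma kdist_nonneg {n : ℕ} (a b : Alloc n) : 0 ≤ kdist a b :=
  Finset.sum_nonneg fun _ _ => abs_nonneg _

lemma exists_near {n : ℕ} {c : Fin n → ℕ → ℕ → ℝ} {x r : Alloc n} (hr : IsMin' c x r) :
    ∃ s, IsMin' c x s ∧ ∀ y, IsMin' c x y → kdist x s ≤ kdist x y := by
  obtain ⟨s, hs, hmin⟩ := WellFounded.has_min (measure fun y : Alloc n => (kdist x y).toNat).wf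
    {y | IsMin' c x y} ⟨r, hr⟩
  refine ⟨s, hs, fun y hy => ?_⟩
  have h1 : ¬ ((kdist x y).toNat < (kdist x s).toNat) := hmin y hy
  have := kdist_nonneg x y
  omega

lemma IsMin'.congr {n : ℕ} {c : Fin n → ℕ → ℕ → ℝ} {x x' s : Alloc n} (h : IsMin' c x s)
    (hs : Same x' x) : IsMin' c x' s :=
  ⟨h.1.trans hs.symm, fun y hy => h.2 y (hy.trans hs)⟩

lemma descent {n : ℕ} {c : Fin n → ℕ → ℕ → ℝ} (hc : ∀ i, Multimodular (c i)) (m : ℕ) :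
    ∀ (seq : ℕ → Alloc n), BikeOptimal c (seq 0) →
      (∀ t, seq (t + 1) ∈ Neighborhood (seq t) ∪ {seq t} ∧
        ∀ x ∈ Neighborhood (seq t) ∪ {seq t}, obj c (seq (t + 1)) ≤ obj c x) →
      ∀ r, IsMin' c (seq 0) r → kdist (seq 0) r ≤ 2 * m →
      obj c (seq m) ≤ obj c r := by
  induction m with
  | zero =>
    intro seq hb _ r hr hd
    refine bo hb (fun k => ?_) hr.1
    have h0 : kdist (seq 0) r = 0 := le_antisymm (by simpa using hd) (kdist_nonneg _ _)
    have := (Finset.sum_eq_zero_iff_of_nonneg (fun i _ => abs_nonneg _)).1 h0 k (Finset.mem_univ _)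
    rw [abs_eq_zero] at this
    omega
  | succ m ih =>
    intro seq hb hseq r hr hd
    obtain ⟨hmem, hmin⟩ := hseq 0
    obtain ⟨hb1, hs1⟩ := bo_step hc hb hmem hmin
    have key := ih (fun t => seq (t+1)) hb1 (fun t => hseq (t+1))
    obtain ⟨s, hs, hnear⟩ := exists_near hr
    by_cases hlt : obj c s < obj c (seq 0)
    · obtain ⟨q, hq, hqd⟩ := approach hc hb hmem hmin hs hnear hlt
      have h1 := hnear r hr
      have h2 := key q (hq.congr hs1) (by push_cast at hd ⊢; simp only [zero_add] at *; omega)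
      exact h2.trans (hq.2 r hr.1)
    · have h1 : obj c (seq (0+1)) ≤ obj c (seq 0) := hmin _ (Or.inr rfl)
      have hm : IsMin' c (seq 0) (seq (0+1)) :=
        ⟨hs1, fun y hy => by have := hs.2 y hy; linarith⟩
      have h2 := key (seq (0+1)) (hm.congr hs1) (by simp [kdist])
      exact h2.trans (hm.2 r hr.1)

lemma exists_min {n : ℕ} (c : Fin n → ℕ → ℕ → ℝ) (a : Alloc n) : ∃ r, IsMin' c a r := by
  have hfin : {y : Alloc n | Same y a}.Finite := by
    apply ((Set.finite_Iic (fun _ : Fin n => ∑ i, a.1 i)).prod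
      (Set.finite_Iic (fun _ : Fin n => ∑ i, a.2 i))).subset
    intro y hy
    refine ⟨fun k => ?_, fun k => ?_⟩
    · rw [← hy.1]
      exact Finset.single_le_sum (f := y.1) (fun _ _ => Nat.zero_le _) (Finset.mem_univ k)
    · rw [← hy.2]
      exact Finset.single_le_sum (f := y.2) (fun _ _ => Nat.zero_le _) (Finset.mem_univ k)
  obtain ⟨r, hr, h⟩ := Set.exists_min_image _ (obj c) hfin ⟨a, rfl, rfl⟩
  exact ⟨r, hr, fun y hy => h y hy⟩

lemma ball_succ' {n : ℕ} {a x y : Alloc n} (hx : x ∈ Neighborhood a) (z : ℕ)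
    (hy : y ∈ ball x z) : y ∈ ball a (z+1) := by
  induction z generalizing y with
  | zero =>
    have : y = x := hy
    subst this
    exact Or.inr (Set.mem_iUnion₂.2 ⟨a, rfl, hx⟩)
  | succ z ih =>
    rcases hy with hy | hy
    · exact Or.inl (ih hy)
    · obtain ⟨w, hw, hyw⟩ := Set.mem_iUnion₂.1 hy
      exact Or.inr (Set.mem_iUnion₂.2 ⟨w, ih hw, hyw⟩)

lemma self_ball {n : ℕ} (a : Alloc n) (z : ℕ) : a ∈ ball a z := by
  induction z with
  | zero => rfl
  | succ z ih => exact Or.inl ih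

def l1 {n : ℕ} (f g : Fin n → ℕ) : ℤ := ∑ i, |(f i : ℤ) - g i|

lemma l1_move {n : ℕ} {f g : Fin n → ℕ} {u v : Fin n} (hu : g u < f u) (hv : f v < g v) :
    l1 (moveOne f u v) g ≤ l1 f g - 2 := by
  have huv : u ≠ v := by rintro rfl; omega
  have : ∑ k, |(moveOne f u v k : ℤ) - g k| ≤
      ∑ k, (|(f k : ℤ) - g k| + (-1) * dl u k + (-1) * dl v k) := by
    apply Finset.sum_le_sum
    intro k _
    rw [moveOne_cast _ _ _ (by omega)]
    unfold dl
    by_cases e1 : k = u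
    · subst e1; simp only [huv, if_true, if_false, Int.abs_eq_natAbs]; omega
    by_cases e2 : k = v
    · subst e2; simp only [e1, if_true, if_false, Int.abs_eq_natAbs]; omega
    simp [e1, e2]
  simp only [Finset.sum_add_distrib, ← Finset.mul_sum, sum_dl, mul_one] at this
  unfold l1
  omega

lemma exists_gt_of_ne {n : ℕ} {f g : Fin n → ℕ} (h : ∑ i, f i = ∑ i, g i) (hne : f ≠ g) :
    ∃ u, g u < f u := by
  by_contra hcon
  push Not at hcon
  apply hne
  funext k
  exact (Finset.sum_eq_sum_iff_of_le (fun i _ => hcon i)).1 h k (Finset.mem_univ k)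

lemma l1_nonneg {n : ℕ} (f g : Fin n → ℕ) : 0 ≤ l1 f g :=
  Finset.sum_nonneg fun _ _ => abs_nonneg _

lemma l1_le {n : ℕ} (f g : Fin n → ℕ) : l1 f g ≤ ((∑ i, f i + ∑ i, g i : ℕ) : ℤ) := by
  push_cast
  rw [← Finset.sum_add_distrib]
  exact Finset.sum_le_sum fun i _ => by rw [Int.abs_eq_natAbs]; omega

lemma mem_ball {n : ℕ} (y : Alloc n) (z : ℕ) : ∀ a : Alloc n, Same a y →
    l1 a.1 y.1 + l1 a.2 y.2 ≤ 2 * z → y ∈ ball a z := by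
  induction z with
  | zero =>
    intro a hs h
    have n1 := l1_nonneg a.1 y.1
    have n2 := l1_nonneg a.2 y.2
    have : a = y := by
      apply Prod.ext
      · by_contra hne
        obtain ⟨u, hu⟩ := exists_gt_of_ne hs.1 hne
        obtain ⟨v, hv⟩ := exists_lt_of_sum hs.1 hu
        have := l1_move hu hv
        have := l1_nonneg (moveOne a.1 u v) y.1
        push_cast at h; omega
      · by_contra hne
        obtain ⟨u, hu⟩ := exists_gt_of_ne hs.2 hne
        obtain ⟨v, hv⟩ := exists_lt_of_sum hs.2 hu
        have := l1_move hu hv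
        have := l1_nonneg (moveOne a.2 u v) y.2
        push_cast at h; omega
    subst this
    rfl
  | succ z ih =>
    intro a hs h
    push_cast at h
    by_cases h1 : a.1 = y.1
    · by_cases h2 : a.2 = y.2
      · have : a = y := Prod.ext h1 h2
        subst this
        exact self_ball _ _
      · obtain ⟨u, hu⟩ := exists_gt_of_ne hs.2 h2
        obtain ⟨v, hv⟩ := exists_lt_of_sum hs.2 hu
        have hm := l1_move hu hv
        refine ball_succ' (x := (a.1, moveOne a.2 u v))
          (move_nbr (i := u) (j := v) (Or.inr (Or.inl ⟨by omega, rfl⟩))) z (ih _ ?_ ?_)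
        · exact ⟨hs.1, (moveOne_sum _ _ _ (by omega)).trans hs.2⟩
        · simp only; omega
    · obtain ⟨u, hu⟩ := exists_gt_of_ne hs.1 h1
      obtain ⟨v, hv⟩ := exists_lt_of_sum hs.1 hu
      have hm := l1_move hu hv
      refine ball_succ' (x := (moveOne a.1 u v, a.2))
        (move_nbr (i := u) (j := v) (Or.inl ⟨by omega, rfl⟩)) z (ih _ ?_ ?_)
      · exact ⟨(moveOne_sum _ _ _ (by omega)).trans hs.1, hs.2⟩
      · simp only; omega

lemma same_of {n : ℕ} {a a' : Alloc n}
    (h1 : ∑ i, (a'.1 i + a'.2 i) = ∑ i, (a.1 i + a.2 i)) (h2 : ∑ i, a'.2 i = ∑ i, a.2 i) :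
    Same a' a := by
  refine ⟨?_, h2⟩
  rw [Finset.sum_add_distrib, Finset.sum_add_distrib] at h1
  omega

lemma kdist_bound {n : ℕ} {a r : Alloc n} (h : Same r a) :
    kdist a r ≤ 2 * ((∑ i, (a.1 i + a.2 i) : ℕ) : ℤ) := by
  have h1 : kdist a r ≤ ∑ i, (((a.1 i + a.2 i : ℕ) : ℤ) + ((r.1 i + r.2 i : ℕ) : ℤ)) :=
    Finset.sum_le_sum fun i _ => by unfold KK; rw [Int.abs_eq_natAbs]; omega
  have h2 : ∑ i, (r.1 i + r.2 i) = ∑ i, (a.1 i + a.2 i) := by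
    rw [Finset.sum_add_distrib, Finset.sum_add_distrib, h.1, h.2]
  rw [Finset.sum_add_distrib, ← Nat.cast_sum, ← Nat.cast_sum, h2] at h1
  linarith

/-- (i) For any allocation `a` and any `z ≥ Σ_i (d_i+b_i)`, the `z`-ball `S_z(a)`
contains every allocation with the same total number of docks and the same total number
of bikes; (ii) consequently, starting from a bike-optimal allocation, the discrete
gradient-descent sequence attains a global minimum of the objective over all allocations
with the same totals after at most `Σ_i (d_i+b_i)` iterations. -/
theorem ball_covers_and_descent_terminates {n : ℕ} (c : Fin n → ℕ → ℕ → ℝ)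
    (hc : ∀ i, Multimodular (c i)) (a : Alloc n) :
    (∀ z : ℕ, ∑ i, (a.1 i + a.2 i) ≤ z → ∀ a' : Alloc n,
      (∑ i, (a'.1 i + a'.2 i) = ∑ i, (a.1 i + a.2 i)) →
      (∑ i, a'.2 i = ∑ i, a.2 i) → a' ∈ ball a z) ∧
    (BikeOptimal c a → ∀ seq : ℕ → Alloc n, seq 0 = a →
      (∀ t, seq (t + 1) ∈ Neighborhood (seq t) ∪ {seq t} ∧
        ∀ x ∈ Neighborhood (seq t) ∪ {seq t}, obj c (seq (t + 1)) ≤ obj c x) →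
      ∀ a' : Alloc n,
        (∑ i, (a'.1 i + a'.2 i) = ∑ i, (a.1 i + a.2 i)) →
        (∑ i, a'.2 i = ∑ i, a.2 i) →
        obj c (seq (∑ i, (a.1 i + a.2 i))) ≤ obj c a') := by
  refine ⟨fun z hz a' h1 h2 => ?_, fun hb seq h0 hseq a' h1 h2 => ?_⟩
  · have hs := same_of h1 h2
    refine mem_ball a' z a hs.symm ?_
    have l1' := l1_le a.1 a'.1
    have l2' := l1_le a.2 a'.2
    rw [hs.1] at l1'
    rw [hs.2] at l2'
    rw [Finset.sum_add_distrib] at hz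
    omega
  · have hs := same_of h1 h2
    obtain ⟨r, hr⟩ := exists_min c a
    have := descent hc (∑ i, (a.1 i + a.2 i)) seq (by rw [h0]; exact hb) hseq r
      (by rw [h0]; exact hr) (by rw [h0]; exact kdist_bound hr.1)
    exact this.trans (hr.2 a' hs)
end
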